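/- Let F : ℝ → ℝ be infinitely differentiable, and suppose Y : ℝ → ℝ is differentiable with Y'(λ) = F(Y(λ)) for all λ and Y(0) = 0. Define F₁ = F and F_{j+1} = (F_j)'·F for j ≥ 1. Then for every n ≥ 1, Y(Δ) = Σ_{j=1}^{n} (F_j(0)/j!)·Δ^j + o(Δⁿ) as Δ → 0. In particular the jump correction term Y(Δ) agrees to every finite order with the Di Paola–Falsone series Σ_{j≥1} (F_j(0)/j!)·Δ^j. -/

import Mathlib

open Asymptotics Filter

/-- The iterated Di Paola–Falsone coefficient functions:
`diPaolaIter F 0 = F₁ = F` and `diPaolaIter F j = F_{j+1} = (F_j)' · F`. -/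
noncomputable def diPaolaIter (F : ℝ → ℝ) : ℕ → (ℝ → ℝ)
  | 0 => F
  | n + 1 => fun y => deriv (diPaolaIter F n) y * F y

theorem contDiff_diPaolaIter {F : ℝ → ℝ} (hF : ContDiff ℝ (⊤ : ℕ∞) F) (n : ℕ) :
    ContDiff ℝ (⊤ : ℕ∞) (diPaolaIter F n) := by
  induction n with
  | zero => exact hF
  | succ n ih => exact (contDiff_infty_iff_deriv.1 ih).2.mul hF

/-- Along a solution of `Y' = F(Y)`, the higher derivatives of `Y` are the coefficient functions
evaluated along `Y`. -/
theorem iteratedDeriv_succ_eq_diPaolaIter {F Y : ℝ → ℝ} (hF : ContDiff ℝ (⊤ : ℕ∞) F)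
    (hY : ∀ t : ℝ, HasDerivAt Y (F (Y t)) t) (n : ℕ) :
    iteratedDeriv (n + 1) Y = fun t => diPaolaIter F n (Y t) := by
  induction n with
  | zero =>
    rw [zero_add, iteratedDeriv_one]
    exact funext fun t => (hY t).deriv
  | succ n ih =>
    rw [iteratedDeriv_succ, ih]
    funext t
    have hd : DifferentiableAt ℝ (diPaolaIter F n) (Y t) :=
      (contDiff_diPaolaIter hF n).differentiable (by simp) (Y t)
    exact (hd.hasDerivAt.comp t (hY t)).deriv

theorem contDiff_of_hasDerivAt_comp_self {F Y : ℝ → ℝ} (hF : ContDiff ℝ (⊤ : ℕ∞) F)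
    (hY : ∀ t : ℝ, HasDerivAt Y (F (Y t)) t) : ContDiff ℝ (⊤ : ℕ∞) Y := by
  have hd : Differentiable ℝ Y := fun t => (hY t).differentiableAt
  refine contDiff_of_differentiable_iteratedDeriv fun m _ => ?_
  cases m with
  | zero => simpa using hd
  | succ m =>
    rw [iteratedDeriv_succ_eq_diPaolaIter hF hY]
    exact ((contDiff_diPaolaIter hF m).differentiable (by simp)).comp hd

/-- The jump correction term `Y(Δ)` agrees to every finite order with the
Di Paola–Falsone series `Σ_{j≥1} (F_j(0)/j!)·Δ^j`. -/
theorem diPaolaFalsone_series_expansion (F : ℝ → ℝ) (hF : ContDiff ℝ (⊤ : ℕ∞) F)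
    (Y : ℝ → ℝ) (hY : ∀ lam : ℝ, HasDerivAt Y (F (Y lam)) lam) (hY0 : Y 0 = 0) :
    ∀ n : ℕ, 1 ≤ n →
      (fun Δ : ℝ => Y Δ - ∑ j ∈ Finset.Icc 1 n, (diPaolaIter F (j - 1) 0 / (j.factorial : ℝ)) * Δ ^ j)
        =o[nhds (0:ℝ)] fun Δ : ℝ => Δ ^ n := by
  intro n _
  have hsmooth : ContDiff ℝ n Y :=
    (contDiff_of_hasDerivAt_comp_self hF hY).of_le (by exact_mod_cast le_top)
  have htaylor := taylor_isLittleO_univ (x₀ := 0) hsmooth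
  simp only [sub_zero] at htaylor
  refine htaylor.congr_left fun Δ => ?_
  rw [taylor_within_apply, Finset.range_eq_Ico, Finset.sum_eq_sum_Ico_succ_bot n.succ_pos]
  simp only [iteratedDerivWithin_univ, iteratedDeriv_zero, hY0, zero_add,
    sub_zero, smul_eq_mul, mul_zero]
  refine congrArg (Y Δ - ·) (Finset.sum_congr (by ext j; simp) fun j hj => ?_)
  obtain ⟨k, rfl⟩ : ∃ k, j = k + 1 := ⟨j - 1, by grind⟩
  simp only [iteratedDeriv_succ_eq_diPaolaIter hF hY, hY0, Nat.add_sub_cancel]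
  ring
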